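/- arXiv:math/0210129 — 2 statements merged into one kernel-verified Lean document; each statement's English description precedes it below -/
import Mathlib

section
/- Let K be a field of characteristic 2, let A = K[U,V,W,X,Y,Z]_m/(UX+VY+WZ) be the localization of K[U,V,W,X,Y,Z]/(UX+VY+WZ) at the maximal ideal m = (U,V,W,X,Y,Z), with u,v,w,x,y,z the images of the variables, let L = Frac(A), let Ω be an algebraic closure of L, and let a, b, c, d, e ∈ Ω be the square roots of uyz, vxz, wxy, uvw, vwyz respectively. Let R = A[a,b,c,d,e] ⊆ Ω. Then R is finitely generated as an A-module and the fraction field of R equals L(a,b), which is an extension of L of degree 4; in particular, R has rank 4 as an A-module. -/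
open MvPolynomial

set_option maxHeartbeats 1000000
set_option synthInstance.maxHeartbeats 1000000

noncomputable section

/-- The polynomial `UX + VY + WZ` (variables: `0 = U, 1 = V, 2 = W, 3 = X, 4 = Y, 5 = Z`). -/
def bPoly (K : Type) [Field K] : MvPolynomial (Fin 6) K :=
  X 0 * X 3 + X 1 * X 4 + X 2 * X 5

/-- The hypersurface `K[U,V,W,X,Y,Z]/(UX+VY+WZ)`. -/
def Bring (K : Type) [Field K] : Type :=
  MvPolynomial (Fin 6) K ⧸ Ideal.span {bPoly K}

instance (K : Type) [Field K] : CommRing (Bring K) :=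
  inferInstanceAs (CommRing (MvPolynomial (Fin 6) K ⧸ Ideal.span {bPoly K}))

/-- The quotient map onto the hypersurface. -/
def bMk (K : Type) [Field K] : MvPolynomial (Fin 6) K →+* Bring K :=
  Ideal.Quotient.mk (Ideal.span {bPoly K})

/-- The maximal ideal of `Bring K` generated by the images of the variables. -/
def mIdeal (K : Type) [Field K] : Ideal (Bring K) :=
  Ideal.span (Set.range fun i : Fin 6 => bMk K (X i))

/-- `A`, the localization of the hypersurface at the maximal ideal `m`. -/
def Aring (K : Type) [Field K] [(mIdeal K).IsPrime] : Type :=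
  Localization (mIdeal K).primeCompl

instance (K : Type) [Field K] [(mIdeal K).IsPrime] : CommRing (Aring K) :=
  inferInstanceAs (CommRing (Localization (mIdeal K).primeCompl))

instance (K : Type) [Field K] [(mIdeal K).IsPrime] : Algebra (Bring K) (Aring K) :=
  inferInstanceAs (Algebra (Bring K) (Localization (mIdeal K).primeCompl))

variable (K : Type) [Field K] [(mIdeal K).IsPrime]

/-- `u`, the image of `U` in `A`. -/
def uElt : Aring K := algebraMap (Bring K) (Aring K) (bMk K (X 0))
/-- `v`, the image of `V` in `A`. -/
def vElt : Aring K := algebraMap (Bring K) (Aring K) (bMk K (X 1))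
/-- `w`, the image of `W` in `A`. -/
def wElt : Aring K := algebraMap (Bring K) (Aring K) (bMk K (X 2))
/-- `x`, the image of `X` in `A`. -/
def xElt : Aring K := algebraMap (Bring K) (Aring K) (bMk K (X 3))
/-- `y`, the image of `Y` in `A`. -/
def yElt : Aring K := algebraMap (Bring K) (Aring K) (bMk K (X 4))
/-- `z`, the image of `Z` in `A`. -/
def zElt : Aring K := algebraMap (Bring K) (Aring K) (bMk K (X 5))

/-- The ideal `P = (u, v, w)` of `A`. -/
def Pideal : Ideal (Aring K) := Ideal.span {uElt K, vElt K, wElt K}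

/-- `L = Frac(A)`, the fraction field of `A`. -/
def Lfield (K : Type) [Field K] [(mIdeal K).IsPrime] : Type :=
  FractionRing (Aring K)

instance (K : Type) [Field K] [(mIdeal K).IsPrime] [IsDomain (Aring K)] :
    Field (Lfield K) := inferInstanceAs (Field (FractionRing (Aring K)))

instance (K : Type) [Field K] [(mIdeal K).IsPrime] [IsDomain (Aring K)] :
    Algebra (Aring K) (Lfield K) := inferInstanceAs (Algebra (Aring K) (FractionRing (Aring K)))

variable (K : Type) [Field K] [(mIdeal K).IsPrime] [IsDomain (Aring K)]

/-- `Ω`, an algebraic closure of `L`. -/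
def Omega : Type := AlgebraicClosure (Lfield K)

instance : Field (Omega K) := inferInstanceAs (Field (AlgebraicClosure (Lfield K)))

instance : Algebra (Lfield K) (Omega K) :=
  inferInstanceAs (Algebra (Lfield K) (AlgebraicClosure (Lfield K)))

instance : IsAlgClosed (Omega K) := inferInstanceAs (IsAlgClosed (AlgebraicClosure (Lfield K)))

instance : Algebra.IsAlgebraic (Lfield K) (Omega K) :=
  inferInstanceAs (Algebra.IsAlgebraic (Lfield K) (AlgebraicClosure (Lfield K)))

instance : Algebra (Aring K) (Omega K) :=
  ((algebraMap (Lfield K) (Omega K)).comp (algebraMap (Aring K) (Lfield K))).toAlgebra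

/-- The image of an element of `A` in `Ω`. -/
def toOmega (α : Aring K) : Omega K := algebraMap (Aring K) (Omega K) α

instance : IsFractionRing (Aring K) (Lfield K) :=
  inferInstanceAs (IsFractionRing (Aring K) (FractionRing (Aring K)))

instance : IsScalarTower (Aring K) (Lfield K) (Omega K) := .of_algebraMap_eq fun _ => rfl

instance (K : Type) [Field K] [(mIdeal K).IsPrime] :
    IsLocalization (mIdeal K).primeCompl (Aring K) :=
  inferInstanceAs (IsLocalization (mIdeal K).primeCompl (Localization (mIdeal K).primeCompl))

/-- The canonical map from the polynomial ring to `L`. -/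
def polyToL : MvPolynomial (Fin 6) K →+* Lfield K :=
  (algebraMap (Aring K) (Lfield K)).comp ((algebraMap (Bring K) (Aring K)).comp (bMk K))

theorem bMk_surjective (K : Type) [Field K] : Function.Surjective (bMk K) :=
  Ideal.Quotient.mk_surjective

theorem bMk_eq_zero_iff {K : Type} [Field K] {h : MvPolynomial (Fin 6) K} :
    bMk K h = 0 ↔ bPoly K ∣ h :=
  Ideal.Quotient.eq_zero_iff_mem.trans Ideal.mem_span_singleton

theorem polyToL_ne_zero_of_notMem {t : MvPolynomial (Fin 6) K} (ht : bMk K t ∉ mIdeal K) :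
    polyToL K t ≠ 0 := by
  have hu : IsUnit (algebraMap (Bring K) (Aring K) (bMk K t)) :=
    IsLocalization.map_units (Aring K) (⟨bMk K t, ht⟩ : (mIdeal K).primeCompl)
  exact (hu.map (algebraMap (Aring K) (Lfield K))).ne_zero

theorem polyToL_eq_zero_iff {h : MvPolynomial (Fin 6) K} :
    polyToL K h = 0 ↔ ∃ t, bMk K t ∉ mIdeal K ∧ bPoly K ∣ t * h := by
  constructor
  · intro hh
    have h1 : algebraMap (Bring K) (Aring K) (bMk K h) = 0 :=
      (map_eq_zero_iff _ (IsFractionRing.injective (Aring K) (Lfield K))).1 hh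
    obtain ⟨⟨m, hm⟩, hmh⟩ := (IsLocalization.map_eq_zero_iff (mIdeal K).primeCompl _ _).1 h1
    obtain ⟨t, rfl⟩ := bMk_surjective K m
    exact ⟨t, hm, bMk_eq_zero_iff.1 (by rw [map_mul]; exact hmh)⟩
  · rintro ⟨t, ht, hd⟩
    have : polyToL K (t * h) = 0 := by
      simp only [polyToL, RingHom.comp_apply, bMk_eq_zero_iff.2 hd, map_zero]
    rw [map_mul] at this
    exact (mul_eq_zero.1 this).resolve_left (polyToL_ne_zero_of_notMem K ht)

theorem exists_polyToL_fraction (l : Lfield K) :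
    ∃ p t, polyToL K t ≠ 0 ∧ l * polyToL K t = polyToL K p := by
  have frac_A (r : Aring K) : ∃ p t, polyToL K t ≠ 0 ∧
      algebraMap _ (Lfield K) r * polyToL K t = polyToL K p := by
    obtain ⟨⟨p, ⟨t, ht⟩⟩, h⟩ := IsLocalization.surj (mIdeal K).primeCompl r
    obtain ⟨p, rfl⟩ := bMk_surjective K p
    obtain ⟨t, rfl⟩ := bMk_surjective K t
    exact ⟨p, t, polyToL_ne_zero_of_notMem K ht,
      by simpa [polyToL] using congrArg (algebraMap (Aring K) (Lfield K)) h⟩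
  obtain ⟨r, s, hs, rfl⟩ := IsFractionRing.div_surjective (A := Aring K) l
  have hs0 : algebraMap (Aring K) (Lfield K) s ≠ 0 :=
    IsFractionRing.to_map_ne_zero_of_mem_nonZeroDivisors hs
  obtain ⟨p, t, ht, hp⟩ := frac_A r
  obtain ⟨q, t', ht', hq⟩ := frac_A s
  refine ⟨p * t', t * q, ?_, ?_⟩
  · rw [map_mul, ← hq]
    exact mul_ne_zero ht (mul_ne_zero hs0 ht')
  · rw [map_mul, map_mul, ← hp, ← hq]
    field_simp

theorem polyToL_bPoly : polyToL K (bPoly K) = 0 :=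
  (polyToL_eq_zero_iff K).2 ⟨1, fun h1 => Ideal.IsPrime.ne_top' ((Ideal.eq_top_iff_one _).2
    (by simpa using h1)), by simp⟩

theorem polyToL_derivation_eq_zero
    (D : Derivation K (MvPolynomial (Fin 6) K) (MvPolynomial (Fin 6) K))
    (hD : D (bPoly K) = 0) {h : MvPolynomial (Fin 6) K} (hh : polyToL K h = 0) :
    polyToL K (D h) = 0 := by
  obtain ⟨t, ht, g, hg⟩ := (polyToL_eq_zero_iff K).1 hh
  have key := congrArg (polyToL K) (congrArg D hg)
  simp only [Derivation.leibniz, hD, smul_eq_mul, map_add, map_mul, hh, polyToL_bPoly, map_zero] at key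
  exact (mul_eq_zero.1 (by linear_combination key)).resolve_left (polyToL_ne_zero_of_notMem K ht)

theorem bMk_mem_mIdeal_of_constantCoeff {K : Type} [Field K] {t : MvPolynomial (Fin 6) K}
    (ht : constantCoeff t = 0) : bMk K t ∈ mIdeal K := by
  have h1 : t ∈ Ideal.span (Set.range (X : Fin 6 → MvPolynomial (Fin 6) K)) := by
    rw [← Set.image_univ, mem_ideal_span_X_image]
    intro m hm
    by_contra! hc
    have : m = 0 := by ext i; simpa using hc i
    subst this
    exact mem_support_iff.1 hm ht
  have h2 := Ideal.mem_map_of_mem (bMk K) h1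
  rw [Ideal.map_span, ← Set.range_comp] at h2
  exact h2

theorem polyToL_X_ne_zero (i : Fin 6) : polyToL K (X i) ≠ 0 := by
  intro h
  obtain ⟨t, ht, hd⟩ := (polyToL_eq_zero_iff K).1 h
  let ev : MvPolynomial (Fin 6) K →ₐ[K] Polynomial K :=
    aeval fun j => if j = i then Polynomial.X else 0
  have hF : ev (bPoly K) = 0 := by
    fin_cases i <;> simp [ev, bPoly]
  have h0 := map_dvd ev hd
  rw [hF, zero_dvd_iff, map_mul] at h0
  have hX : ev (X i) = Polynomial.X := by simp [ev]
  have h1 : ev t = 0 := (mul_eq_zero.1 h0).resolve_right (by rw [hX]; exact Polynomial.X_ne_zero)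
  apply ht
  apply bMk_mem_mIdeal_of_constantCoeff
  have h2 : (Polynomial.aeval (0 : K)).comp ev = aeval (fun _ => (0 : K)) := by
    ext j
    by_cases hj : j = i <;> simp [ev, hj]
  have h3 := DFunLike.congr_fun h2 t
  rw [AlgHom.comp_apply, h1, map_zero] at h3
  simpa [aeval_zero'] using h3.symm

theorem polyToL_X_relation :
    polyToL K (X 0) * polyToL K (X 3) + polyToL K (X 1) * polyToL K (X 4)
      + polyToL K (X 2) * polyToL K (X 5) = 0 := by
  simpa [bPoly] using polyToL_bPoly K

theorem two_eq_zero_Lfield [CharP K 2] : (2 : Lfield K) = 0 := by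
  have h : (2 : MvPolynomial (Fin 6) K) = 0 := CharP.cast_eq_zero (MvPolynomial (Fin 6) K) 2
  simpa only [map_ofNat, map_zero] using congrArg (polyToL K) h

theorem squares_combination_polynomial [CharP K 2] (p q r s : MvPolynomial (Fin 6) K)
    (h : polyToL K (p ^ 2 + q ^ 2 * (X 0 * X 4 * X 5) + r ^ 2 * (X 1 * X 3 * X 5)
      + s ^ 2 * ((X 0 * X 4 * X 5) * (X 1 * X 3 * X 5))) = 0) :
    polyToL K p = 0 ∧ polyToL K q = 0 ∧ polyToL K r = 0 ∧ polyToL K s = 0 := by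
  have h2 : (2 : MvPolynomial (Fin 6) K) = 0 := CharP.cast_eq_zero (MvPolynomial (Fin 6) K) 2
  have h2L := two_eq_zero_Lfield K
  let D₁ : Derivation K (MvPolynomial (Fin 6) K) (MvPolynomial (Fin 6) K) :=
    mkDerivation K ![X 0, 0, 0, X 3, 0, 0]
  let D₂ : Derivation K (MvPolynomial (Fin 6) K) (MvPolynomial (Fin 6) K) :=
    mkDerivation K ![X 4, X 3, 0, 0, 0, 0]
  have hD₁ : D₁ (bPoly K) = 0 := by
    simp [D₁, bPoly, mkDerivation_X]
    linear_combination (X 0 * X 3) * h2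
  have hD₂ : D₂ (bPoly K) = 0 := by
    simp [D₂, bPoly, mkDerivation_X]
    linear_combination (X 4 * X 3) * h2
  have E₁ : D₁ (p ^ 2 + q ^ 2 * (X 0 * X 4 * X 5) + r ^ 2 * (X 1 * X 3 * X 5)
      + s ^ 2 * ((X 0 * X 4 * X 5) * (X 1 * X 3 * X 5)))
      = q ^ 2 * (X 0 * X 4 * X 5) + r ^ 2 * (X 1 * X 3 * X 5) := by
    simp [D₁, mkDerivation_X, Derivation.leibniz_pow]
    linear_combination (p * D₁ p + q * D₁ q * (X 0 * X 4 * X 5) + r * D₁ r * (X 1 * X 3 * X 5)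
      + (s * D₁ s + s ^ 2) * ((X 0 * X 4 * X 5) * (X 1 * X 3 * X 5))) * h2
  have E₂ : D₂ (p ^ 2 + q ^ 2 * (X 0 * X 4 * X 5) + r ^ 2 * (X 1 * X 3 * X 5)
      + s ^ 2 * ((X 0 * X 4 * X 5) * (X 1 * X 3 * X 5)))
      = q ^ 2 * (X 4 ^ 2 * X 5) + r ^ 2 * (X 3 ^ 2 * X 5)
        + s ^ 2 * (X 3 * X 4 * X 5 ^ 2 * (X 0 * X 3 + X 1 * X 4)) := by
    simp [D₂, mkDerivation_X, Derivation.leibniz_pow]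
    linear_combination (p * D₂ p + q * D₂ q * (X 0 * X 4 * X 5) + r * D₂ r * (X 1 * X 3 * X 5)
      + s * D₂ s * ((X 0 * X 4 * X 5) * (X 1 * X 3 * X 5))) * h2
  have E₃ : D₂ (q ^ 2 * (X 0 * X 4 * X 5) + r ^ 2 * (X 1 * X 3 * X 5))
      = q ^ 2 * (X 4 ^ 2 * X 5) + r ^ 2 * (X 3 ^ 2 * X 5) := by
    simp [D₂, mkDerivation_X, Derivation.leibniz_pow]
    linear_combination (q * D₂ q * (X 0 * X 4 * X 5) + r * D₂ r * (X 1 * X 3 * X 5)) * h2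
  have e₁ := polyToL_derivation_eq_zero K D₁ hD₁ h
  have e₂ := polyToL_derivation_eq_zero K D₂ hD₂ h
  rw [E₁] at e₁
  have e₃ := polyToL_derivation_eq_zero K D₂ hD₂ e₁
  rw [E₂] at e₂
  rw [E₃] at e₃
  have hF := polyToL_X_relation K
  have hw := polyToL_X_ne_zero K 2
  have hx := polyToL_X_ne_zero K 3
  have hy := polyToL_X_ne_zero K 4
  have hz := polyToL_X_ne_zero K 5
  simp only [map_add, map_mul, map_pow] at h e₁ e₂ e₃
  have hs : polyToL K s = 0 := by
    have : polyToL K s ^ 2 * (polyToL K (X 2) * polyToL K (X 3) * polyToL K (X 4)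
        * polyToL K (X 5) ^ 3) = 0 := by
      linear_combination e₃ - e₂ + polyToL K s ^ 2 * (polyToL K (X 3) * polyToL K (X 4)
        * polyToL K (X 5) ^ 2) * hF
    simpa [hw, hx, hy, hz] using this
  have hq : polyToL K q = 0 := by
    have : polyToL K q ^ 2 * (polyToL K (X 2) * polyToL K (X 3) * polyToL K (X 4)
        * polyToL K (X 5) ^ 3) = 0 := by
      linear_combination polyToL K (X 1) * polyToL K (X 3) * polyToL K (X 5) * e₃
        - polyToL K (X 3) ^ 2 * polyToL K (X 5) * e₁
        + polyToL K q ^ 2 * (polyToL K (X 3) * polyToL K (X 4) * polyToL K (X 5) ^ 2) * hF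
        - polyToL K q ^ 2 * (polyToL K (X 1) * polyToL K (X 3) * polyToL K (X 4) ^ 2
          * polyToL K (X 5) ^ 2) * h2L
    simpa [hw, hx, hy, hz] using this
  have hr : polyToL K r = 0 := by
    simpa [hq, hx, hz] using e₃
  have hp : polyToL K p = 0 := by
    simpa [hq, hr, hs] using h
  exact ⟨hp, hq, hr, hs⟩

theorem squares_combination_Lfield [CharP K 2] (p q r s : Lfield K)
    (h : p ^ 2 + q ^ 2 * polyToL K (X 0 * X 4 * X 5) + r ^ 2 * polyToL K (X 1 * X 3 * X 5)
      + s ^ 2 * (polyToL K (X 0 * X 4 * X 5) * polyToL K (X 1 * X 3 * X 5)) = 0) :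
    p = 0 ∧ q = 0 ∧ r = 0 ∧ s = 0 := by
  obtain ⟨p', t₁, h₁, hp⟩ := exists_polyToL_fraction K p
  obtain ⟨q', t₂, h₂, hq⟩ := exists_polyToL_fraction K q
  obtain ⟨r', t₃, h₃, hr⟩ := exists_polyToL_fraction K r
  obtain ⟨s', t₄, h₄, hs⟩ := exists_polyToL_fraction K s
  have key := squares_combination_polynomial K (p' * (t₂ * t₃ * t₄)) (q' * (t₁ * t₃ * t₄))
    (r' * (t₁ * t₂ * t₄)) (s' * (t₁ * t₂ * t₃)) (by
      simp only [map_add, map_mul, map_pow, ← hp, ← hq, ← hr, ← hs] at h ⊢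
      linear_combination (polyToL K t₁ * polyToL K t₂ * polyToL K t₃ * polyToL K t₄) ^ 2 * h)
  simpa [← hp, ← hq, ← hr, ← hs, h₁, h₂, h₃, h₄] using key

section Biquadratic

variable {F E : Type*} [Field F] [Field E] [Algebra F E] {f g : F} {a b : E}

theorem linearIndependent_of_sq (h2 : (2 : E) = 0)
    (ha : a ^ 2 = algebraMap F E f) (hb : b ^ 2 = algebraMap F E g)
    (hfg : ∀ p q r s : F, p ^ 2 + q ^ 2 * f + r ^ 2 * g + s ^ 2 * (f * g) = 0 →
      p = 0 ∧ q = 0 ∧ r = 0 ∧ s = 0) :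
    LinearIndependent F ![1, a, b, a * b] := by
  rw [Fintype.linearIndependent_iff]
  intro k hk
  simp only [Fin.sum_univ_four, Algebra.smul_def] at hk
  simp only [Matrix.cons_val_zero, Matrix.cons_val_one, Matrix.cons_val] at hk
  obtain ⟨h₀, h₁, h₃, h₄⟩ := hfg (k 0) (k 1) (k 2) (k 3) (by
    apply (algebraMap F E).injective
    simp only [map_add, map_mul, map_pow, map_zero, ← ha, ← hb]
    generalize algebraMap F E (k 0) = p at *
    generalize algebraMap F E (k 1) = q at *
    generalize algebraMap F E (k 2) = r at *
    generalize algebraMap F E (k 3) = s at *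
    linear_combination (p * 1 + q * a + r * b + s * (a * b)) * hk
      - (p * q * a + p * r * b + p * s * (a * b) + q * r * (a * b) + q * s * a * (a * b)
        + r * s * b * (a * b)) * h2)
  intro i
  fin_cases i <;> assumption

theorem IntermediateField.finrank_adjoin_simple_le_two_of_sq (ha : a ^ 2 = algebraMap F E f) :
    Module.finrank F (IntermediateField.adjoin F {a}) ≤ 2 := by
  have hm : (Polynomial.X ^ 2 - Polynomial.C f).Monic :=
    Polynomial.monic_X_pow_sub_C f two_ne_zero
  have h0 : Polynomial.aeval a (Polynomial.X ^ 2 - Polynomial.C f) = 0 := by simp [ha]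
  rw [IntermediateField.adjoin.finrank ⟨_, hm, h0⟩]
  exact (Polynomial.natDegree_le_of_dvd (minpoly.dvd F a h0) hm.ne_zero).trans
    (Polynomial.natDegree_X_pow_sub_C).le

theorem eq_of_sq_eq_sq_of_two_eq_zero {s t : E} (h2 : (2 : E) = 0) (h : s ^ 2 = t ^ 2) : s = t := by
  have : (s - t) ^ 2 = 0 := by linear_combination h - (s * t - t ^ 2) * h2
  exact sub_eq_zero.1 (pow_eq_zero_iff two_ne_zero |>.1 this)

theorem isIntegral_of_sq {R S : Type*} [CommRing R] [CommRing S] [Algebra R S] {s : S} {r : R}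
    (h : s ^ 2 = algebraMap R S r) : IsIntegral R s :=
  .of_pow two_pos (h ▸ isIntegral_algebraMap)

theorem IntermediateField.finite_adjoin_pair_of_sq
    (ha : a ^ 2 = algebraMap F E f) (hb : b ^ 2 = algebraMap F E g) :
    Module.Finite F (IntermediateField.adjoin F {a, b}) :=
  IntermediateField.finiteDimensional_adjoin (by
    rintro x (rfl | rfl)
    exacts [isIntegral_of_sq ha, isIntegral_of_sq hb])

theorem IntermediateField.finrank_adjoin_pair_le_four_of_sq
    (ha : a ^ 2 = algebraMap F E f) (hb : b ^ 2 = algebraMap F E g) :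
    Module.finrank F (IntermediateField.adjoin F {a, b}) ≤ 4 := by
  rw [← Set.singleton_union, IntermediateField.adjoin_union]
  exact (IntermediateField.finrank_sup_le _ _).trans
    (Nat.mul_le_mul (finrank_adjoin_simple_le_two_of_sq ha) (finrank_adjoin_simple_le_two_of_sq hb))

theorem Submodule.finrank_eq_of_linearIndependent_of_le {ι V : Type*} [Fintype ι]
    [AddCommGroup V] [Module F V] {v : ι → V} (hv : LinearIndependent F v)
    {N M : Submodule F V} [Module.Finite F M] (hvN : ∀ i, v i ∈ N) (hNM : N ≤ M)
    (hM : Module.finrank F M ≤ Fintype.card ι) : Module.finrank F N = Fintype.card ι := by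
  have : Module.Finite F N := Submodule.finiteDimensional_of_le hNM
  refine ((Submodule.finrank_mono hNM).trans hM).antisymm ?_
  have : LinearIndependent F fun i => (⟨v i, hvN i⟩ : N) :=
    LinearIndependent.of_comp N.subtype hv
  exact this.fintype_card_le_finrank

end Biquadratic

/-- Over the fraction field `F` of `A`, the base change of a submodule of an `F`-vector space is
its `F`-span. -/
theorem finrank_tensorProduct_eq_finrank_span {A F V : Type*} [CommRing A] [IsDomain A] [Field F]
    [Algebra A F] [IsFractionRing A F] [AddCommGroup V] [Module A V] [Module F V]
    [IsScalarTower A F V] (N : Submodule A V) :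
    Module.finrank F (TensorProduct A F N) = Module.finrank F (Submodule.span F (N : Set V)) := by
  let μ : TensorProduct A F N →ₗ[F] V := TensorProduct.AlgebraTensorModule.lift
    (LinearMap.toSpanSingleton F (N →ₗ[A] V) N.subtype)
  have hμ (l : F) (n : N) : μ (l ⊗ₜ n) = l • (n : V) := by simp [μ]
  have hinj : Function.Injective μ := by
    rw [injective_iff_map_eq_zero]
    intro t ht
    obtain ⟨⟨n, s⟩, hn⟩ := IsLocalizedModule.surj (nonZeroDivisors A)
      (TensorProduct.mk A F N 1) t
    have hsn : (s : A) • t = 1 ⊗ₜ n := hn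
    have hs0 : algebraMap A F s ≠ 0 := IsFractionRing.to_map_ne_zero_of_mem_nonZeroDivisors s.2
    have hst : algebraMap A F s • t = 1 ⊗ₜ n := by rw [algebraMap_smul, hsn]
    have hn0 : (n : V) = 0 := by
      rw [← one_smul F (n : V), ← hμ, ← hst, map_smul, ht, smul_zero]
    rw [(Submodule.coe_eq_zero.1 hn0 : n = 0), TensorProduct.tmul_zero] at hst
    exact (smul_eq_zero.1 hst).resolve_left hs0
  have hrange : LinearMap.range μ = Submodule.span F (N : Set V) := by
    apply le_antisymm
    · rintro _ ⟨t, rfl⟩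
      induction t with
      | zero => simp
      | tmul l n =>
        rw [hμ]
        exact Submodule.smul_mem _ _ (Submodule.subset_span n.2)
      | add x y hx hy => rw [map_add]; exact add_mem hx hy
    · rw [Submodule.span_le]
      intro n hn
      exact ⟨1 ⊗ₜ ⟨n, hn⟩, by rw [hμ, one_smul]⟩
  rw [← hrange, LinearMap.finrank_range_of_inj hinj]

/-- `R = A[a,b,c,d,e]` is finitely generated as an `A`-module, its fraction
field (the smallest subfield of `Ω` containing it) equals `L(a,b)`, which has degree `4`
over `L`; in particular `R` has rank `4` as an `A`-module, i.e.
`dim_L (L ⊗_A R) = 4`. -/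
theorem adjoined_ring_module_finite_and_rank_four
    (K : Type) [Field K] [CharP K 2] [(mIdeal K).IsPrime] [IsDomain (Aring K)]
    (a b c d e : Omega K)
    (ha : a ^ 2 = toOmega K (uElt K * yElt K * zElt K))
    (hb : b ^ 2 = toOmega K (vElt K * xElt K * zElt K))
    (hc : c ^ 2 = toOmega K (wElt K * xElt K * yElt K))
    (hd : d ^ 2 = toOmega K (uElt K * vElt K * wElt K))
    (he : e ^ 2 = toOmega K (vElt K * wElt K * yElt K * zElt K)) :
    Module.Finite (Aring K) (Algebra.adjoin (Aring K) ({a, b, c, d, e} : Set (Omega K))) ∧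
    IntermediateField.adjoin (Lfield K)
        ((Algebra.adjoin (Aring K) ({a, b, c, d, e} : Set (Omega K))) : Set (Omega K)) =
      IntermediateField.adjoin (Lfield K) ({a, b} : Set (Omega K)) ∧
    Module.finrank (Lfield K)
        (IntermediateField.adjoin (Lfield K) ({a, b} : Set (Omega K))) = 4 ∧
    Module.finrank (Lfield K)
        (TensorProduct (Aring K) (Lfield K)
          (Algebra.adjoin (Aring K) ({a, b, c, d, e} : Set (Omega K)))) = 4 := by
  have h2 : (2 : Omega K) = 0 := by
    simpa only [map_ofNat, map_zero] using
      congrArg (algebraMap (Lfield K) (Omega K)) (two_eq_zero_Lfield K)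
  have ha' : a ^ 2 = algebraMap (Lfield K) (Omega K) (polyToL K (X 0 * X 4 * X 5)) := by
    rw [ha]; simp only [toOmega, map_mul]; rfl
  have hb' : b ^ 2 = algebraMap (Lfield K) (Omega K) (polyToL K (X 1 * X 3 * X 5)) := by
    rw [hb]; simp only [toOmega, map_mul]; rfl
  have hc' : c ^ 2 = algebraMap (Lfield K) (Omega K) (polyToL K (X 2 * X 3 * X 4)) := by
    rw [hc]; simp only [toOmega, map_mul]; rfl
  have hd' : d ^ 2 = algebraMap (Lfield K) (Omega K) (polyToL K (X 0 * X 1 * X 2)) := by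
    rw [hd]; simp only [toOmega, map_mul]; rfl
  have he' : e ^ 2 = algebraMap (Lfield K) (Omega K) (polyToL K (X 1 * X 2 * X 4 * X 5)) := by
    rw [he]; simp only [toOmega, map_mul]; rfl
  have hli := linearIndependent_of_sq h2 ha' hb' (squares_combination_Lfield K)
  have hle := IntermediateField.finrank_adjoin_pair_le_four_of_sq ha' hb'
  have hfin := IntermediateField.finite_adjoin_pair_of_sq ha' hb'
  have haM : a ∈ IntermediateField.adjoin (Lfield K) {a, b} :=
    IntermediateField.subset_adjoin _ _ (by simp)
  have hbM : b ∈ IntermediateField.adjoin (Lfield K) {a, b} :=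
    IntermediateField.subset_adjoin _ _ (by simp)
  have hsub : ((Algebra.adjoin (Aring K) ({a, b, c, d, e} : Set (Omega K))) : Set (Omega K)) ⊆
      IntermediateField.adjoin (Lfield K) ({a, b} : Set (Omega K)) := by
    set M := IntermediateField.adjoin (Lfield K) ({a, b} : Set (Omega K))
    have hz : algebraMap (Lfield K) (Omega K) (polyToL K (X 5)) ≠ 0 :=
      (map_ne_zero _).2 (polyToL_X_ne_zero K 5)
    have hF := congrArg (algebraMap (Lfield K) (Omega K)) (polyToL_X_relation K)
    have hM (i : Fin 6) : algebraMap (Lfield K) (Omega K) (polyToL K (X i)) ∈ M :=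
      M.algebraMap_mem _
    simp only [map_add, map_mul, map_zero] at hF ha' hb' hc' hd' he'
    have hu := hM 0
    have hv := hM 1
    have hx := hM 3
    have hy := hM 4
    have hzM := hM 5
    clear hM
    generalize algebraMap (Lfield K) (Omega K) (polyToL K (X 0)) = u at *
    generalize algebraMap (Lfield K) (Omega K) (polyToL K (X 1)) = v at *
    generalize algebraMap (Lfield K) (Omega K) (polyToL K (X 2)) = w at *
    generalize algebraMap (Lfield K) (Omega K) (polyToL K (X 3)) = x at *
    generalize algebraMap (Lfield K) (Omega K) (polyToL K (X 4)) = y at *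
    generalize algebraMap (Lfield K) (Omega K) (polyToL K (X 5)) = z at *
    have hcz : c * z = x * a + y * b := eq_of_sq_eq_sq_of_two_eq_zero h2 (by
      linear_combination z ^ 2 * hc' - x ^ 2 * ha' - y ^ 2 * hb' - x * y * z * hF
        + (w * x * y * z ^ 2 - x * y * a * b) * h2)
    have hdz : d * z = u * b + v * a := eq_of_sq_eq_sq_of_two_eq_zero h2 (by
      linear_combination z ^ 2 * hd' - u ^ 2 * hb' - v ^ 2 * ha' - u * v * z * hF
        + (u * v * w * z ^ 2 - u * v * a * b) * h2)
    have hez : e * z = a * b + v * y * z := eq_of_sq_eq_sq_of_two_eq_zero h2 (by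
      linear_combination z ^ 2 * he' - b ^ 2 * ha' - u * y * z * hb' - v * y * z ^ 2 * hF
        + (v * w * y * z ^ 3 - a * b * v * y * z) * h2)
    have hc0 : c ∈ M := by
      rw [eq_div_of_mul_eq hz hcz]
      exact div_mem (add_mem (mul_mem hx haM) (mul_mem hy hbM)) hzM
    have hd0 : d ∈ M := by
      rw [eq_div_of_mul_eq hz hdz]
      exact div_mem (add_mem (mul_mem hu hbM) (mul_mem hv haM)) hzM
    have he0 : e ∈ M := by
      rw [eq_div_of_mul_eq hz hez]
      exact div_mem (add_mem (mul_mem haM hbM) (mul_mem (mul_mem hv hy) hzM)) hzM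
    change Algebra.adjoin (Aring K) ({a, b, c, d, e} : Set (Omega K)) ≤
      M.toSubalgebra.restrictScalars (Aring K)
    rw [Algebra.adjoin_le_iff]
    rintro _ (rfl | rfl | rfl | rfl | rfl) <;> assumption
  have haR : a ∈ Algebra.adjoin (Aring K) ({a, b, c, d, e} : Set (Omega K)) :=
    Algebra.subset_adjoin (by simp)
  have hbR : b ∈ Algebra.adjoin (Aring K) ({a, b, c, d, e} : Set (Omega K)) :=
    Algebra.subset_adjoin (by simp)
  refine ⟨?_, ?_, ?_, ?_⟩
  · apply Algebra.finite_adjoin_of_finite_of_isIntegral (Set.toFinite _)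
    rintro _ (rfl | rfl | rfl | rfl | rfl)
    exacts [isIntegral_of_sq ha, isIntegral_of_sq hb, isIntegral_of_sq hc, isIntegral_of_sq hd,
      isIntegral_of_sq he]
  · apply le_antisymm
    · exact IntermediateField.adjoin_le_iff.2 hsub
    · apply IntermediateField.adjoin.mono
      rintro _ (rfl | rfl)
      exacts [haR, hbR]
  · refine Submodule.finrank_eq_of_linearIndependent_of_le hli
      (N := (IntermediateField.adjoin (Lfield K) ({a, b} : Set (Omega K))).toSubmodule)
      (fun i => ?_) le_rfl hle
    fin_cases i
    exacts [IntermediateField.one_mem _, haM, hbM, IntermediateField.mul_mem _ haM hbM]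
  · refine (finrank_tensorProduct_eq_finrank_span (F := Lfield K) (Subalgebra.toSubmodule
      (Algebra.adjoin (Aring K) ({a, b, c, d, e} : Set (Omega K))))).trans ?_
    refine Submodule.finrank_eq_of_linearIndependent_of_le hli
      (M := (IntermediateField.adjoin (Lfield K) ({a, b} : Set (Omega K))).toSubmodule)
      (fun i => Submodule.subset_span ?_) (Submodule.span_le.2 hsub) hle
    fin_cases i
    exacts [Subalgebra.one_mem _, haR, hbR, Subalgebra.mul_mem _ haR hbR]
end
end

section
/- Let K be a field of characteristic 2, let A = K[U,V,W,X,Y,Z]_m/(UX+VY+WZ) be the localization of K[U,V,W,X,Y,Z]/(UX+VY+WZ) at the maximal ideal m = (U,V,W,X,Y,Z), with u,v,w,x,y,z the images of the variables, let Ω be an algebraic closure of Frac(A), let a, b, c, d, e ∈ Ω be the square roots of uyz, vxz, wxy, uvw, vwyz respectively, and let R = A[a,b,c,d,e] ⊆ Ω. Then u, x, v, y, w−z is a regular sequence on R; that is, u is a nonzerodivisor on R, x is a nonzerodivisor on R/(u), v is a nonzerodivisor on R/(u,x), y is a nonzerodivisor on R/(u,x,v), w−z is a nonzerodivisor on R/(u,x,v,y),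 and (u,x,v,y,w−z)R ≠ R. -/
open MvPolynomial

set_option maxHeartbeats 1000000
set_option synthInstance.maxHeartbeats 1000000

noncomputable section

variable (K : Type) [Field K] [(mIdeal K).IsPrime]

variable (K : Type) [Field K] [(mIdeal K).IsPrime] [IsDomain (Aring K)]

variable (a b c d e : Omega K)

/-- The subring `R = A[a,b,c,d,e]` of `Ω`. -/
def adjoinT : Subalgebra (Aring K) (Omega K) :=
  Algebra.adjoin (Aring K) {a, b, c, d, e}

/-- The image of `u` in `R`. -/
def uT : adjoinT K a b c d e := algebraMap (Aring K) (adjoinT K a b c d e) (uElt K)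
/-- The image of `v` in `R`. -/
def vT : adjoinT K a b c d e := algebraMap (Aring K) (adjoinT K a b c d e) (vElt K)
/-- The image of `w` in `R`. -/
def wT : adjoinT K a b c d e := algebraMap (Aring K) (adjoinT K a b c d e) (wElt K)
/-- The image of `x` in `R`. -/
def xT : adjoinT K a b c d e := algebraMap (Aring K) (adjoinT K a b c d e) (xElt K)
/-- The image of `y` in `R`. -/
def yT : adjoinT K a b c d e := algebraMap (Aring K) (adjoinT K a b c d e) (yElt K)
/-- The image of `z` in `R`. -/
def zT : adjoinT K a b c d e := algebraMap (Aring K) (adjoinT K a b c d e) (zElt K)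

/-- `a` as an element of `R`. -/
def aT : adjoinT K a b c d e := ⟨a, Algebra.subset_adjoin (by simp)⟩
/-- `b` as an element of `R`. -/
def bT : adjoinT K a b c d e := ⟨b, Algebra.subset_adjoin (by simp)⟩
/-- `c` as an element of `R`. -/
def cT : adjoinT K a b c d e := ⟨c, Algebra.subset_adjoin (by simp)⟩
/-- `d` as an element of `R`. -/
def dT : adjoinT K a b c d e := ⟨d, Algebra.subset_adjoin (by simp)⟩
/-- `e` as an element of `R`. -/
def eT : adjoinT K a b c d e := ⟨e, Algebra.subset_adjoin (by simp)⟩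

section RegularSequence

variable {F σ ι R : Type*} [Field F] [Fintype ι] [CommRing R]
  (θ : MvPolynomial σ F →+* R) (g : ι → R)

theorem mem_span_X_of_X_mul_mem {s : Set σ} {k : σ} (hk : k ∉ s) {p : MvPolynomial σ F}
    (h : X k * p ∈ Ideal.span (X '' s : Set (MvPolynomial σ F))) :
    p ∈ Ideal.span (X '' s : Set (MvPolynomial σ F)) := by
  classical
  rw [mem_ideal_span_X_image] at h ⊢
  intro m hm
  obtain ⟨i, hi, h0⟩ := h (m + Finsupp.single k 1) (by
    rw [mem_support_iff, mul_comm, coeff_mul_X]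
    exact mem_support_iff.1 hm)
  refine ⟨i, hi, ?_⟩
  have hik : k ≠ i := fun h => hk (h ▸ hi)
  simpa [Finsupp.single_apply, hik] using h0

/-- If the `g i` generate `R` over `θ` up to denominators with nonzero constant coefficient, then
elements of the extension of `span (X '' s)` have coordinates in `span (X '' s)`. -/
theorem exists_coords_of_mem_span
    (hgen : ∀ r, ∃ n, constantCoeff n ≠ 0 ∧ ∃ c : ι → MvPolynomial σ F,
      θ n * r = ∑ i, θ (c i) * g i)
    {s : Set σ} {r : R} (hr : r ∈ Ideal.span ((fun i => θ (X i)) '' s)) :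
    ∃ n, constantCoeff n ≠ 0 ∧ ∃ c : ι → MvPolynomial σ F,
      (∀ i, c i ∈ Ideal.span (X '' s : Set (MvPolynomial σ F))) ∧
      θ n * r = ∑ i, θ (c i) * g i := by
  suffices H : ∀ b : R, ∃ n, constantCoeff n ≠ 0 ∧ ∃ c : ι → MvPolynomial σ F,
      (∀ i, c i ∈ Ideal.span (X '' s : Set (MvPolynomial σ F))) ∧
      θ n * (b * r) = ∑ i, θ (c i) * g i by simpa using H 1
  induction hr using Submodule.span_induction with
  | mem x hx =>
    obtain ⟨j, hj, rfl⟩ := hx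
    intro b
    obtain ⟨n, hn, c, hc⟩ := hgen b
    refine ⟨n, hn, fun i => c i * X j, fun i => Ideal.mul_mem_left _ _
      (Ideal.subset_span ⟨j, hj, rfl⟩), ?_⟩
    rw [← mul_assoc, hc, Finset.sum_mul]
    exact Finset.sum_congr rfl fun i _ => by rw [map_mul]; ring
  | zero => exact fun b => ⟨1, by simp, 0, by simp, by simp⟩
  | add x y _ _ hx hy =>
    intro b
    obtain ⟨n, hn, c, hc, hcx⟩ := hx b
    obtain ⟨n', hn', c', hc', hcy⟩ := hy b
    refine ⟨n * n', by simp [hn, hn'], fun i => n' * c i + n * c' i, fun i =>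
      add_mem (Ideal.mul_mem_left _ _ (hc i)) (Ideal.mul_mem_left _ _ (hc' i)), ?_⟩
    calc θ (n * n') * (b * (x + y))
        = θ n' * (θ n * (b * x)) + θ n * (θ n' * (b * y)) := by rw [map_mul]; ring
      _ = _ := by
        rw [hcx, hcy, Finset.mul_sum, Finset.mul_sum, ← Finset.sum_add_distrib]
        exact Finset.sum_congr rfl fun i _ => by rw [map_add, map_mul, map_mul]; ring
  | smul a x _ hx =>
    intro b
    simpa [mul_assoc] using hx (b * a)

variable {θ g}

theorem coords_unique
    (hli : ∀ c : ι → MvPolynomial σ F, ∑ i, θ (c i) * g i = 0 → c = 0)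
    {c c' : ι → MvPolynomial σ F} (h : ∑ i, θ (c i) * g i = ∑ i, θ (c' i) * g i) : c = c' := by
  refine sub_eq_zero.1 (hli (c - c') ?_)
  simp [sub_mul, h]

theorem mem_span_of_X_mul_mem
    (hli : ∀ c : ι → MvPolynomial σ F, ∑ i, θ (c i) * g i = 0 → c = 0)
    (hgen : ∀ r, ∃ n, constantCoeff n ≠ 0 ∧ ∃ c : ι → MvPolynomial σ F,
      θ n * r = ∑ i, θ (c i) * g i)
    (hunit : ∀ n, constantCoeff n ≠ 0 → IsUnit (θ n))
    {s : Set σ} {k : σ} (hk : k ∉ s) {r : R}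
    (hr : θ (X k) * r ∈ Ideal.span ((fun i => θ (X i)) '' s)) :
    r ∈ Ideal.span ((fun i => θ (X i)) '' s) := by
  obtain ⟨n, hn, c, hc, h⟩ := exists_coords_of_mem_span θ g hgen hr
  obtain ⟨n', hn', c', h'⟩ := hgen r
  have key : (fun i => X k * (n * c' i)) = fun i => n' * c i := by
    apply coords_unique hli
    calc ∑ i, θ (X k * (n * c' i)) * g i = θ (X k) * θ n * ∑ i, θ (c' i) * g i := by
          rw [Finset.mul_sum]
          exact Finset.sum_congr rfl fun i _ => by rw [map_mul, map_mul]; ring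
      _ = θ n' * (θ n * (θ (X k) * r)) := by rw [← h']; ring
      _ = ∑ i, θ (n' * c i) * g i := by
          rw [h, Finset.mul_sum]
          exact Finset.sum_congr rfl fun i _ => by rw [map_mul]; ring
  have hmem (i : ι) : n * c' i ∈ Ideal.span (X '' s : Set (MvPolynomial σ F)) := by
    refine mem_span_X_of_X_mul_mem hk ?_
    rw [congrFun key i]
    exact Ideal.mul_mem_left _ _ (hc i)
  have hmap (p : MvPolynomial σ F) (hp : p ∈ Ideal.span (X '' s : Set (MvPolynomial σ F))) :
      θ p ∈ Ideal.span ((fun i => θ (X i)) '' s) := by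
    have := Ideal.mem_map_of_mem θ hp
    rwa [Ideal.map_span, Set.image_image] at this
  have hu := hunit (n * n') (by simp [hn, hn'])
  rw [← Ideal.unit_mul_mem_iff_mem _ hu]
  have : θ (n * n') * r = ∑ i, θ (n * c' i) * g i := by
    rw [map_mul, mul_assoc, h', Finset.mul_sum]
    exact Finset.sum_congr rfl fun i _ => by rw [map_mul]; ring
  rw [this]
  exact sum_mem fun i _ => Ideal.mul_mem_right _ _ (hmap _ (hmem i))

theorem span_X_ne_top
    (hli : ∀ c : ι → MvPolynomial σ F, ∑ i, θ (c i) * g i = 0 → c = 0)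
    (hgen : ∀ r, ∃ n, constantCoeff n ≠ 0 ∧ ∃ c : ι → MvPolynomial σ F,
      θ n * r = ∑ i, θ (c i) * g i)
    {i₀ : ι} (h₀ : g i₀ = 1) (s : Set σ) :
    Ideal.span ((fun i => θ (X i)) '' s) ≠ ⊤ := by
  classical
  intro htop
  obtain ⟨n, hn, c, hc, h⟩ := exists_coords_of_mem_span θ g hgen
    ((Ideal.eq_top_iff_one _).1 htop)
  have key : Pi.single i₀ n = c := by
    apply coords_unique hli
    rw [← h, Finset.sum_eq_single i₀] <;> simp +contextual [h₀]
  have hle : Ideal.span (X '' s : Set (MvPolynomial σ F)) ≤ RingHom.ker constantCoeff := by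
    rw [Ideal.span_le]
    rintro _ ⟨j, -, rfl⟩
    simp
  apply hn
  have := hle (hc i₀)
  rwa [← key, Pi.single_eq_same] at this

end RegularSequence

section CharTwo

variable {F σ : Type*} [Field F] [CharP F 2]

theorem pderiv_sq_eq_zero (i : σ) (p : MvPolynomial σ F) : pderiv i (p ^ 2) = 0 := by
  rw [Derivation.leibniz_pow]
  simp [CharTwo.two_eq_zero]

theorem pderiv_mul_sq (i : σ) (m p : MvPolynomial σ F) :
    pderiv i (m * p ^ 2) = pderiv i m * p ^ 2 := by
  rw [pderiv_mul, pderiv_sq_eq_zero, mul_zero, add_zero]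

theorem coeffs_eq_zero_of_sq_combination {α β γ δ : MvPolynomial (Fin 5) F}
    (h : X 0 * X 3 * α ^ 2 + X 2 * X 1 * β ^ 2 + X 1 * X 3 * γ ^ 2 + X 0 * X 2 * δ ^ 2 = 0) :
    α = 0 ∧ β = 0 ∧ γ = 0 ∧ δ = 0 := by
  have hα := congrArg (fun p => pderiv 0 (pderiv 3 p)) h
  have hβ := congrArg (fun p => pderiv 2 (pderiv 1 p)) h
  have hγ := congrArg (fun p => pderiv 1 (pderiv 3 p)) h
  have hδ := congrArg (fun p => pderiv 0 (pderiv 2 p)) h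
  simp only [map_add, map_zero, pderiv_mul_sq] at hα hβ hγ hδ
  simp [pderiv_X] at hα hβ hγ hδ
  exact ⟨hα, hβ, hγ, hδ⟩

theorem coeffs_eq_zero_of_sq_add {p q : MvPolynomial (Fin 5) F}
    (h : p ^ 2 + X 2 * X 3 * (X 0 * X 1 + X 2 * X 3) * q ^ 2 = 0) : p = 0 ∧ q = 0 := by
  have hq := congrArg (fun p => pderiv 0 (pderiv 1 p)) h
  simp only [map_add, map_zero, pderiv_mul_sq, pderiv_sq_eq_zero] at hq
  simp [pderiv_X] at hq
  subst hq
  simpa using h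

theorem coeffs_eq_zero_of_quad_relation {p₀ p₁ q₀ q₁ α β γ δ : MvPolynomial (Fin 5) F}
    (h₁ : X 4 * p₁ ^ 2 + X 4 * (X 2 * X 3 * (X 0 * X 1 + X 2 * X 3)) * q₁ ^ 2
      + X 0 * X 3 * α ^ 2 + X 2 * X 1 * β ^ 2 + X 1 * X 3 * γ ^ 2 + X 0 * X 2 * δ ^ 2 = 0)
    (h₀ : p₀ ^ 2 + (X 0 * X 1 + X 2 * X 3) * p₁ ^ 2
      + X 2 * X 3 * (X 0 * X 1 + X 2 * X 3) * (q₀ ^ 2 + (X 0 * X 1 + X 2 * X 3) * q₁ ^ 2)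
      + X 1 * X 3 * X 4 * γ ^ 2 + X 0 * X 2 * X 4 * δ ^ 2 = 0) :
    p₀ = 0 ∧ p₁ = 0 ∧ q₀ = 0 ∧ q₁ = 0 ∧ α = 0 ∧ β = 0 ∧ γ = 0 ∧ δ = 0 := by
  have h4 := congrArg (pderiv 4) h₁
  simp only [map_add, map_zero, pderiv_mul_sq] at h4
  simp [pderiv_X] at h4
  obtain ⟨rfl, rfl⟩ := coeffs_eq_zero_of_sq_add h4
  obtain ⟨rfl, rfl, rfl, rfl⟩ := coeffs_eq_zero_of_sq_combination (by simpa using h₁)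
  obtain ⟨rfl, rfl⟩ := coeffs_eq_zero_of_sq_add (p := p₀) (q := q₀) (by simpa using h₀)
  simp

end CharTwo

theorem exists_quadratic_extension.{u} {S : Type u} [CommRing S] (α β : S) :
    ∃ (Q : Type u) (_ : CommRing Q) (ι : S →+* Q) (ω : Q), ω * ω = ι α + ι β * ω ∧
      ∀ p q, ι p + ι q * ω = 0 → p = 0 ∧ q = 0 := by
  refine ⟨QuadraticAlgebra S α β, inferInstance, algebraMap _ _, ⟨0, 1⟩, ?_, fun p q h => ?_⟩
  · ext <;> simp
  · exact ⟨by simpa using congrArg QuadraticAlgebra.re h,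
      by simpa using congrArg QuadraticAlgebra.im h⟩

section Hypersurface

variable (K : Type) [Field K]

/-- The ring map from `K[U,X,V,Y,T]` to the hypersurface sending `T` to `w - z`. -/
def paramB : MvPolynomial (Fin 5) K →+* Bring K :=
  (bMk K).comp (aeval ![X 0, X 3, X 1, X 4, X 2 - X 5] :
    MvPolynomial (Fin 5) K →ₐ[K] MvPolynomial (Fin 6) K).toRingHom

theorem bMk_relation :
    bMk K (X 0) * bMk K (X 3) + bMk K (X 1) * bMk K (X 4) + bMk K (X 2) * bMk K (X 5) = 0 := by
  rw [← map_mul, ← map_mul, ← map_mul, ← map_add, ← map_add]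
  exact Ideal.Quotient.eq_zero_iff_mem.2 (Ideal.subset_span rfl)

theorem paramB_C (k : K) : paramB K (C k) = bMk K (C k) := by simp [paramB]
theorem paramB_X_zero : paramB K (X 0) = bMk K (X 0) := by simp [paramB]
theorem paramB_X_one : paramB K (X 1) = bMk K (X 3) := by simp [paramB]
theorem paramB_X_two : paramB K (X 2) = bMk K (X 1) := by simp [paramB]
theorem paramB_X_three : paramB K (X 3) = bMk K (X 4) := by simp [paramB]
theorem paramB_X_four : paramB K (X 4) = bMk K (X 2) - bMk K (X 5) := by simp [paramB]

theorem two_eq_zero_of_ringHom {F R : Type*} [Field F] [CharP F 2] [CommRing R] (f : F →+* R) :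
    (2 : R) = 0 := by
  rw [← map_ofNat f 2, CharTwo.two_eq_zero, map_zero]

theorem two_eq_zero_Bring [CharP K 2] : (2 : Bring K) = 0 :=
  two_eq_zero_of_ringHom ((bMk K).comp C)

theorem exists_coords_Bring [CharP K 2] (s : Bring K) :
    ∃ p q, s = paramB K p + paramB K q * bMk K (X 5) := by
  obtain ⟨f, rfl⟩ : ∃ f, bMk K f = s := Ideal.Quotient.mk_surjective s
  have h2 := two_eq_zero_Bring K
  have hrel := bMk_relation K
  induction f using MvPolynomial.induction_on with
  | C k => exact ⟨C k, 0, by simp [paramB_C]⟩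
  | add f g hf hg =>
    obtain ⟨p, q, h⟩ := hf
    obtain ⟨p', q', h'⟩ := hg
    exact ⟨p + p', q + q', by rw [map_add, h, h', map_add, map_add]; ring⟩
  | mul_X f i hf =>
    obtain ⟨p, q, h⟩ := hf
    have hz : ∃ p' q', bMk K f * bMk K (X 5) = paramB K p' + paramB K q' * bMk K (X 5) := by
      refine ⟨q * (X 0 * X 1 + X 2 * X 3), p + q * X 4, ?_⟩
      simp only [h, map_add, map_mul, paramB_X_zero, paramB_X_one, paramB_X_two, paramB_X_three,
        paramB_X_four]
      grind
    have hX (j : Fin 5) :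
        ∃ p' q', bMk K f * paramB K (X j) = paramB K p' + paramB K q' * bMk K (X 5) :=
      ⟨p * X j, q * X j, by rw [h, map_mul, map_mul]; ring⟩
    rw [map_mul]
    fin_cases i
    · simpa [paramB_X_zero] using hX 0
    · simpa [paramB_X_two] using hX 2
    · obtain ⟨p₁, q₁, h₁⟩ := hz
      obtain ⟨p₂, q₂, h₂⟩ := hX 4
      refine ⟨p₁ + p₂, q₁ + q₂, ?_⟩
      rw [paramB_X_four] at h₂
      rw [map_add, map_add]
      simp only [Fin.reduceFinMk]
      linear_combination h₁ + h₂
    · simpa [paramB_X_one] using hX 1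
    · simpa [paramB_X_three] using hX 3
    · exact hz

theorem eq_zero_of_coords_Bring [CharP K 2] {p q : MvPolynomial (Fin 5) K}
    (h : paramB K p + paramB K q * bMk K (X 5) = 0) : p = 0 ∧ q = 0 := by
  obtain ⟨Q, _, ι, ω, hω, hli⟩ := exists_quadratic_extension
    (X 0 * X 1 + X 2 * X 3 : MvPolynomial (Fin 5) K) (X 4)
  have h2 : (2 : Q) = 0 := two_eq_zero_of_ringHom (ι.comp C)
  let f : MvPolynomial (Fin 6) K →+* Q :=
    eval₂Hom (ι.comp C) ![ι (X 0), ι (X 2), ω + ι (X 4), ι (X 1), ι (X 3), ω]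
  have hf : ∀ r ∈ Ideal.span {bPoly K}, f r = 0 := by
    intro r hr
    obtain ⟨r, rfl⟩ := Ideal.mem_span_singleton.1 hr
    rw [map_mul]
    have : f (bPoly K) = 0 := by
      simp only [f, bPoly, map_add, map_mul, coe_eval₂Hom, eval₂_X, Matrix.cons_val] at hω ⊢
      linear_combination hω + (ι (X 0) * ι (X 1) + ι (X 2) * ι (X 3) + ω * ι (X 4)) * h2
    rw [this, zero_mul]
  let ψ : Bring K →+* Q := Ideal.Quotient.lift _ f hf
  have hψ (r) : ψ (bMk K r) = f r := Ideal.Quotient.lift_mk _ _ _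
  have hψι : ψ.comp (paramB K) = ι := by
    refine MvPolynomial.ringHom_ext (fun k => ?_) (fun i => ?_)
    · simp [paramB_C, hψ, f]
    · fin_cases i <;>
        simp [paramB_X_zero, paramB_X_one, paramB_X_two, paramB_X_three, paramB_X_four, hψ, f]
  have key := congrArg ψ h
  rw [map_add, map_mul, map_zero, hψ, ← RingHom.comp_apply, ← RingHom.comp_apply, hψι] at key
  exact hli p q (by simpa [f] using key)

theorem constantCoeff_eq_zero_of_mem {p : MvPolynomial (Fin 5) K} (h : paramB K p ∈ mIdeal K) :
    constantCoeff p = 0 := by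
  let f : Bring K →+* K := Ideal.Quotient.lift _ constantCoeff (by
    intro r hr
    obtain ⟨r, rfl⟩ := Ideal.mem_span_singleton.1 hr
    simp [bPoly])
  have hf (r) : f (bMk K r) = constantCoeff r := Ideal.Quotient.lift_mk _ _ _
  have hle : mIdeal K ≤ RingHom.ker f := by
    rw [mIdeal, Ideal.span_le]
    rintro _ ⟨i, rfl⟩
    simp [hf]
  have hcomp : f.comp (paramB K) = constantCoeff := by
    refine MvPolynomial.ringHom_ext (fun k => ?_) (fun i => ?_)
    · simp [paramB_C, hf]
    · fin_cases i <;>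
        simp [paramB_X_zero, paramB_X_one, paramB_X_two, paramB_X_three, paramB_X_four, hf]
  rw [← hcomp]
  exact hle h

theorem paramB_mem_of_constantCoeff_eq_zero {p : MvPolynomial (Fin 5) K}
    (h : constantCoeff p = 0) : paramB K p ∈ mIdeal K := by
  have hX (i : Fin 6) : bMk K (X i) ∈ mIdeal K := Ideal.subset_span ⟨i, rfl⟩
  have hp : p ∈ Ideal.span (X '' Set.univ : Set (MvPolynomial (Fin 5) K)) := by
    rw [mem_ideal_span_X_image]
    intro m hm
    by_contra! h0
    have : m = 0 := Finsupp.ext fun i => h0 i trivial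
    subst this
    exact mem_support_iff.1 hm h
  refine (Ideal.span_le (I := (mIdeal K).comap (paramB K))).2 ?_ hp
  rintro _ ⟨i, -, rfl⟩
  fin_cases i
  · simpa [paramB_X_zero] using hX 0
  · simpa [paramB_X_one] using hX 3
  · simpa [paramB_X_two] using hX 1
  · simpa [paramB_X_three] using hX 4
  · simpa [paramB_X_four] using sub_mem (hX 2) (hX 5)

theorem exists_mul_eq_paramB [CharP K 2] {s : Bring K} (hs : s ∉ mIdeal K) :
    ∃ s' n, constantCoeff n ≠ 0 ∧ s * s' = paramB K n := by
  obtain ⟨p, q, rfl⟩ := exists_coords_Bring K s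
  have h2 := two_eq_zero_Bring K
  have hrel := bMk_relation K
  refine ⟨paramB K p + paramB K q * bMk K (X 2),
    p ^ 2 + p * q * X 4 + q ^ 2 * (X 0 * X 1 + X 2 * X 3), ?_, ?_⟩
  · intro h
    apply hs
    refine add_mem (paramB_mem_of_constantCoeff_eq_zero K ?_)
      (Ideal.mul_mem_left _ _ (Ideal.subset_span ⟨5, rfl⟩))
    simpa using h
  · simp only [map_add, map_mul, map_pow, paramB_X_zero, paramB_X_one, paramB_X_two,
      paramB_X_three, paramB_X_four]
    grind

end Hypersurface

section LocalRing

variable (K : Type) [Field K] [(mIdeal K).IsPrime]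

/-- The ring map from `K[U,X,V,Y,T]` to `A` sending `T` to `w - z`. -/
def paramA : MvPolynomial (Fin 5) K →+* Aring K :=
  (algebraMap (Bring K) (Aring K)).comp (paramB K)

instance : IsLocalization.AtPrime (Aring K) (mIdeal K) :=
  inferInstanceAs (IsLocalization.AtPrime (Localization (mIdeal K).primeCompl) (mIdeal K))

theorem paramA_X_zero : paramA K (X 0) = uElt K := by simp [paramA, paramB_X_zero, uElt]
theorem paramA_X_one : paramA K (X 1) = xElt K := by simp [paramA, paramB_X_one, xElt]
theorem paramA_X_two : paramA K (X 2) = vElt K := by simp [paramA, paramB_X_two, vElt]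
theorem paramA_X_three : paramA K (X 3) = yElt K := by simp [paramA, paramB_X_three, yElt]
theorem paramA_X_four : paramA K (X 4) = wElt K - zElt K := by
  simp [paramA, paramB_X_four, wElt, zElt]

theorem elt_relation : uElt K * xElt K + vElt K * yElt K + wElt K * zElt K = 0 := by
  simpa [uElt, vElt, wElt, xElt, yElt, zElt] using
    congrArg (algebraMap (Bring K) (Aring K)) (bMk_relation K)

theorem isUnit_paramA {n : MvPolynomial (Fin 5) K} (hn : constantCoeff n ≠ 0) :
    IsUnit (paramA K n) :=
  IsLocalization.map_units (M := (mIdeal K).primeCompl) (Aring K)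
    ⟨paramB K n, fun h => hn (constantCoeff_eq_zero_of_mem K h)⟩

theorem exists_coords_Aring [CharP K 2] (r : Aring K) :
    ∃ n, constantCoeff n ≠ 0 ∧
      ∃ p q, paramA K n * r = paramA K p + paramA K q * zElt K := by
  obtain ⟨⟨f, s⟩, h⟩ := IsLocalization.surj (mIdeal K).primeCompl r
  obtain ⟨s', n, hn, hs⟩ := exists_mul_eq_paramB K s.2
  obtain ⟨p, q, hpq⟩ := exists_coords_Bring K (f * s')
  refine ⟨n, hn, p, q, ?_⟩
  have := congrArg (algebraMap (Bring K) (Aring K)) hpq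
  simp only [map_add, map_mul] at this
  simp only [paramA, RingHom.comp_apply, ← hs, map_mul, zElt, ← this, ← h]
  ring

theorem eq_zero_of_coords_Aring [CharP K 2] {p q : MvPolynomial (Fin 5) K}
    (h : paramA K p + paramA K q * zElt K = 0) : p = 0 ∧ q = 0 := by
  have h' : algebraMap (Bring K) (Aring K) (paramB K p + paramB K q * bMk K (X 5)) = 0 := by
    simpa [paramA, zElt] using h
  obtain ⟨s, hs⟩ := (IsLocalization.map_eq_zero_iff (mIdeal K).primeCompl (Aring K) _).1 h'
  obtain ⟨s', n, hn, hss⟩ := exists_mul_eq_paramB K s.2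
  have hn0 : n ≠ 0 := by
    rintro rfl
    simp at hn
  have := eq_zero_of_coords_Bring K (p := n * p) (q := n * q) (by
    rw [map_mul, map_mul, ← hss]
    linear_combination s' * hs)
  simpa [hn0] using this

theorem toOmega_injective [IsDomain (Aring K)] : Function.Injective (toOmega K) :=
  (algebraMap (Lfield K) (Omega K)).injective.comp
    (IsFractionRing.injective (Aring K) (FractionRing (Aring K)))

end LocalRing

section SquareRoots

variable {S : Type*} [CommRing S] [IsDomain S] {u v w x y z a b c d e : S}

/-- The multiplication table of the square roots, together with their linear syzygies. -/
theorem sqrt_mul_table (h2 : (2 : S) = 0) (h : u * x + v * y + w * z = 0)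
    (ha : a ^ 2 = u * y * z) (hb : b ^ 2 = v * x * z) (hc : c ^ 2 = w * x * y)
    (hd : d ^ 2 = u * v * w) (he : e ^ 2 = v * w * y * z) :
    (w * a = y * d + u * c ∧ w * b = x * d + v * c ∧ z * c = x * a + y * b ∧
      z * d = v * a + u * b) ∧
    (e * a = y * z * d ∧ e * b = v * z * c ∧ e * c = w * y * b ∧ e * d = v * w * a) ∧
    (a * b = z * (v * y + e) ∧ a * c = y * (w * z + e) ∧ a * d = u * e ∧ b * c = x * e ∧
      b * d = v * (w * z + e) ∧ c * d = w * (v * y + e)) := by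
  have key {p q : S} (hpq : p ^ 2 = q ^ 2) : p = q := by
    rw [← sub_eq_zero, ← sq_eq_zero_iff]
    linear_combination hpq + (q ^ 2 - p * q) * h2
  refine ⟨⟨key ?_, key ?_, key ?_, key ?_⟩, ⟨key ?_, key ?_, key ?_, key ?_⟩,
    key ?_, key ?_, key ?_, key ?_, key ?_, key ?_⟩ <;> grind

end SquareRoots

section SpanClosed

theorem mul_mem_span_of_forall {P S ι : Type*} [CommRing P] [CommRing S] [Algebra P S]
    {g : ι → S} {r : S} (h : ∀ i, r * g i ∈ Submodule.span P (Set.range g)) {s : S}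
    (hs : s ∈ Submodule.span P (Set.range g)) : r * s ∈ Submodule.span P (Set.range g) := by
  refine (Submodule.span_le
    (p := (Submodule.span P (Set.range g)).comap (LinearMap.mulLeft P r))).2 ?_ hs
  rintro _ ⟨i, rfl⟩
  exact h i

variable {P S : Type*} [CommRing P] [CommRing S] [IsDomain S] [Algebra P S]
  {u v w x y z a b c d e : S}

theorem mul_mem_span_sqrt (h2 : (2 : S) = 0) (h : u * x + v * y + w * z = 0)
    (ha : a ^ 2 = u * y * z) (hb : b ^ 2 = v * x * z) (hc : c ^ 2 = w * x * y)
    (hd : d ^ 2 = u * v * w) (he : e ^ 2 = v * w * y * z)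
    (hu : ∃ p, algebraMap P S p = u) (hv : ∃ p, algebraMap P S p = v)
    (hx : ∃ p, algebraMap P S p = x) (hy : ∃ p, algebraMap P S p = y)
    (ht : ∃ p, algebraMap P S p = w - z) {s : S}
    (hs : s ∈ Submodule.span P (Set.range ![1, z, e, z * e, a, b, c, d])) :
    let N := Submodule.span P (Set.range ![1, z, e, z * e, a, b, c, d])
    z * s ∈ N ∧ a * s ∈ N ∧ b * s ∈ N ∧ c * s ∈ N ∧ d * s ∈ N ∧ e * s ∈ N := by
  intro N
  obtain ⟨⟨hwa, hwb, hzc, hzd⟩, ⟨hea, heb, hec, hed⟩, hab, hac, had, hbc, hbd, hcd⟩ :=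
    sqrt_mul_table h2 h ha hb hc hd he
  have base {q : S} (hq : ∃ p, algebraMap P S p = q) {s : S} (hs : s ∈ N) : q * s ∈ N := by
    obtain ⟨p, rfl⟩ := hq
    rw [← Algebra.smul_def]
    exact N.smul_mem p hs
  have of_eq {p q : S} (hpq : p = q) (hq : q ∈ N) : p ∈ N := hpq ▸ hq
  have mem (i : Fin 8) : (![1, z, e, z * e, a, b, c, d] : Fin 8 → S) i ∈ N :=
    Submodule.subset_span ⟨i, rfl⟩
  have m1 : 1 ∈ N := mem 0
  have mz : z ∈ N := mem 1
  have me : e ∈ N := mem 2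
  have mze : z * e ∈ N := mem 3
  have ma : a ∈ N := mem 4
  have mb : b ∈ N := mem 5
  have mc : c ∈ N := mem 6
  have md : d ∈ N := mem 7
  have stable {r : S} (h1 : r ∈ N) (hz : r * z ∈ N) (he : r * e ∈ N) (hze : r * (z * e) ∈ N)
      (ha : r * a ∈ N) (hb : r * b ∈ N) (hc : r * c ∈ N) (hd : r * d ∈ N) {s : S} (hs : s ∈ N) :
      r * s ∈ N := by
    refine mul_mem_span_of_forall (fun i => ?_) hs
    fin_cases i
    exacts [(mul_one r).symm ▸ h1, hz, he, hze, ha, hb, hc, hd]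
  have zzs {s : S} (hs : s ∈ N) (hzs : z * s ∈ N) : z * (z * s) ∈ N :=
    of_eq (q := u * (x * s) + v * (y * s) + (w - z) * (z * s))
      (by linear_combination z * z * s * h2 - s * h)
      (add_mem (add_mem (base hu (base hx hs)) (base hv (base hy hs))) (base ht hzs))
  have Z {s : S} (hs : s ∈ N) : z * s ∈ N :=
    stable mz (of_eq (by rw [mul_one]) (zzs m1 (of_eq (mul_one z) mz))) mze (zzs me mze)
      (of_eq (q := y * d + u * c - (w - z) * a) (by linear_combination hwa)
        (sub_mem (add_mem (base hy md) (base hu mc)) (base ht ma)))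
      (of_eq (q := x * d + v * c - (w - z) * b) (by linear_combination hwb)
        (sub_mem (add_mem (base hx md) (base hv mc)) (base ht mb)))
      (of_eq hzc (add_mem (base hx ma) (base hy mb)))
      (of_eq hzd (add_mem (base hv ma) (base hu mb))) hs
  have W {s : S} (hs : s ∈ N) : w * s ∈ N :=
    of_eq (q := (w - z) * s + z * s) (by ring) (add_mem (base ht hs) (Z hs))
  have mea : e * a ∈ N := of_eq (by rw [hea, mul_assoc]) (base hy (Z md))
  have meb : e * b ∈ N := of_eq (by rw [heb, mul_assoc]) (base hv (Z mc))
  have mec : e * c ∈ N := of_eq (by rw [hec, mul_assoc]) (W (base hy mb))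
  have med : e * d ∈ N := of_eq (by rw [hed, mul_assoc]) (base hv (W ma))
  have mee : e * e ∈ N := of_eq (q := v * (w * (y * z))) (by linear_combination he)
    (base hv (W (base hy mz)))
  have mvye : v * y + e ∈ N :=
    add_mem (base hv (of_eq (mul_one y).symm (base hy m1))) me
  have mwze : w * z + e ∈ N := add_mem (W mz) me
  have mab : a * b ∈ N := of_eq hab (Z mvye)
  have mac : a * c ∈ N := of_eq hac (base hy mwze)
  have mad : a * d ∈ N := of_eq had (base hu me)
  have mbc : b * c ∈ N := of_eq hbc (base hx me)
  have mbd : b * d ∈ N := of_eq hbd (base hv mwze)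
  have mcd : c * d ∈ N := of_eq hcd (W mvye)
  have maa : a * a ∈ N := of_eq (q := u * (y * z)) (by linear_combination ha)
    (base hu (base hy mz))
  have mbb : b * b ∈ N := of_eq (q := v * (x * z)) (by linear_combination hb)
    (base hv (base hx mz))
  have mcc : c * c ∈ N := of_eq (q := w * (x * (y * 1))) (by linear_combination hc)
    (W (base hx (base hy m1)))
  have mdd : d * d ∈ N := of_eq (q := u * (v * (w * 1))) (by linear_combination hd)
    (base hu (base hv (W m1)))
  have stable' {r : S} (h1 : r ∈ N) (he : e * r ∈ N) (ha : a * r ∈ N) (hb : b * r ∈ N)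
      (hc : c * r ∈ N) (hd : d * r ∈ N) : r * s ∈ N :=
    stable h1 (mul_comm z r ▸ Z h1) (mul_comm e r ▸ he)
      (of_eq (q := z * (e * r)) (by ring) (Z he)) (mul_comm a r ▸ ha) (mul_comm b r ▸ hb)
      (mul_comm c r ▸ hc) (mul_comm d r ▸ hd) hs
  exact ⟨Z hs, stable' ma mea maa (mul_comm a b ▸ mab) (mul_comm a c ▸ mac) (mul_comm a d ▸ mad),
    stable' mb meb mab mbb (mul_comm b c ▸ mbc) (mul_comm b d ▸ mbd),
    stable' mc mec mac mbc mcc (mul_comm c d ▸ mcd), stable' md med mad mbd mcd mdd,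
    stable' me mee (mul_comm e a ▸ mea) (mul_comm e b ▸ meb) (mul_comm e c ▸ mec)
      (mul_comm e d ▸ med)⟩

end SpanClosed

section AdjoinedRing

variable (K : Type) [Field K] [(mIdeal K).IsPrime] [IsDomain (Aring K)] (a b c d e : Omega K)

/-- The ring map from `K[U,X,V,Y,T]` to `R` sending `T` to `w - z`. -/
def paramT : MvPolynomial (Fin 5) K →+* adjoinT K a b c d e :=
  (algebraMap (Aring K) (adjoinT K a b c d e)).comp (paramA K)

/-- A basis of the `K[U,X,V,Y,T]`-algebra generated by the variables and `a, b, c, d, e`. -/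
def genT : Fin 8 → adjoinT K a b c d e :=
  ![1, zT K a b c d e, eT K a b c d e, zT K a b c d e * eT K a b c d e, aT K a b c d e,
    bT K a b c d e, cT K a b c d e, dT K a b c d e]

theorem paramT_X_zero : paramT K a b c d e (X 0) = uT K a b c d e := by
  simp [paramT, paramA_X_zero, uT]
theorem paramT_X_one : paramT K a b c d e (X 1) = xT K a b c d e := by
  simp [paramT, paramA_X_one, xT]
theorem paramT_X_two : paramT K a b c d e (X 2) = vT K a b c d e := by
  simp [paramT, paramA_X_two, vT]
theorem paramT_X_three : paramT K a b c d e (X 3) = yT K a b c d e := by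
  simp [paramT, paramA_X_three, yT]
theorem paramT_X_four : paramT K a b c d e (X 4) = wT K a b c d e - zT K a b c d e := by
  simp [paramT, paramA_X_four, wT, zT]

theorem algebraMap_adjoinT_injective :
    Function.Injective (algebraMap (Aring K) (adjoinT K a b c d e)) := fun _ _ h =>
  toOmega_injective K (congrArg Subtype.val h)

theorem relT : uT K a b c d e * xT K a b c d e + vT K a b c d e * yT K a b c d e
    + wT K a b c d e * zT K a b c d e = 0 := by
  simpa [uT, vT, wT, xT, yT, zT] using
    congrArg (algebraMap (Aring K) (adjoinT K a b c d e)) (elt_relation K)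

variable {K a b c d e}

theorem sq_eq_algebraMap {s : adjoinT K a b c d e} {r : Aring K}
    (h : (s : Omega K) ^ 2 = toOmega K r) :
    s ^ 2 = algebraMap (Aring K) (adjoinT K a b c d e) r :=
  Subtype.ext h

theorem aT_sq (h : a ^ 2 = toOmega K (uElt K * yElt K * zElt K)) :
    aT K a b c d e ^ 2 =
      uT K a b c d e * yT K a b c d e * zT K a b c d e := by
  simpa [uT, yT, zT] using sq_eq_algebraMap (s := aT K a b c d e) h

theorem bT_sq (h : b ^ 2 = toOmega K (vElt K * xElt K * zElt K)) :
    bT K a b c d e ^ 2 =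
      vT K a b c d e * xT K a b c d e * zT K a b c d e := by
  simpa [vT, xT, zT] using sq_eq_algebraMap (s := bT K a b c d e) h

theorem cT_sq (h : c ^ 2 = toOmega K (wElt K * xElt K * yElt K)) :
    cT K a b c d e ^ 2 =
      wT K a b c d e * xT K a b c d e * yT K a b c d e := by
  simpa [wT, xT, yT] using sq_eq_algebraMap (s := cT K a b c d e) h

theorem dT_sq (h : d ^ 2 = toOmega K (uElt K * vElt K * wElt K)) :
    dT K a b c d e ^ 2 =
      uT K a b c d e * vT K a b c d e * wT K a b c d e := by
  simpa [uT, vT, wT] using sq_eq_algebraMap (s := dT K a b c d e) h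

theorem eT_sq (h : e ^ 2 = toOmega K (vElt K * wElt K * yElt K * zElt K)) :
    eT K a b c d e ^ 2 =
      vT K a b c d e * wT K a b c d e * yT K a b c d e * zT K a b c d e := by
  simpa [vT, wT, yT, zT] using sq_eq_algebraMap (s := eT K a b c d e) h

theorem exists_coords_adjoinT [CharP K 2]
    (ha : a ^ 2 = toOmega K (uElt K * yElt K * zElt K))
    (hb : b ^ 2 = toOmega K (vElt K * xElt K * zElt K))
    (hc : c ^ 2 = toOmega K (wElt K * xElt K * yElt K))
    (hd : d ^ 2 = toOmega K (uElt K * vElt K * wElt K))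
    (he : e ^ 2 = toOmega K (vElt K * wElt K * yElt K * zElt K))
    (r : adjoinT K a b c d e) :
    ∃ n, constantCoeff n ≠ 0 ∧ ∃ k : Fin 8 → MvPolynomial (Fin 5) K,
      paramT K a b c d e n * r = ∑ i, paramT K a b c d e (k i) * genT K a b c d e i := by
  let _ : Algebra (MvPolynomial (Fin 5) K) (adjoinT K a b c d e) :=
    (paramT K a b c d e).toAlgebra
  let N := Submodule.span (MvPolynomial (Fin 5) K) (Set.range (genT K a b c d e))
  have base (p : MvPolynomial (Fin 5) K) {s} (hs : s ∈ N) : paramT K a b c d e p * s ∈ N :=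
    N.smul_mem p hs
  have closed {s} (hs : s ∈ N) := mul_mem_span_sqrt
    (two_eq_zero_of_ringHom ((paramT K a b c d e).comp C))
    (relT K a b c d e) (a := aT K a b c d e) (b := bT K a b c d e) (c := cT K a b c d e)
    (d := dT K a b c d e) (e := eT K a b c d e)
    (aT_sq ha) (bT_sq hb) (cT_sq hc) (dT_sq hd) (eT_sq he)
    ⟨X 0, paramT_X_zero K a b c d e⟩ ⟨X 2, paramT_X_two K a b c d e⟩
    ⟨X 1, paramT_X_one K a b c d e⟩ ⟨X 3, paramT_X_three K a b c d e⟩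
    ⟨X 4, paramT_X_four K a b c d e⟩ hs
  suffices H : ∃ n, constantCoeff n ≠ 0 ∧ ∀ s ∈ N, paramT K a b c d e n * r * s ∈ N by
    obtain ⟨n, hn, h⟩ := H
    have h1 := h 1 (Submodule.subset_span ⟨0, rfl⟩)
    rw [mul_one] at h1
    obtain ⟨k, hk⟩ := (Submodule.mem_span_range_iff_exists_fun _).1 h1
    exact ⟨n, hn, k, hk.symm⟩
  obtain ⟨r, hr⟩ := r
  induction hr using Algebra.adjoin_induction with
  | mem r hr =>
    refine ⟨1, by simp, fun s hs => ?_⟩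
    rw [map_one, one_mul]
    obtain ⟨-, h₁, h₂, h₃, h₄, h₅⟩ := closed hs
    obtain rfl | rfl | rfl | rfl | rfl := hr
    exacts [h₁, h₂, h₃, h₄, h₅]
  | algebraMap r =>
    obtain ⟨n, hn, p, q, h⟩ := exists_coords_Aring K r
    refine ⟨n, hn, fun s hs => ?_⟩
    have h' : paramT K a b c d e n * algebraMap (Aring K) (adjoinT K a b c d e) r
        = paramT K a b c d e p + paramT K a b c d e q * zT K a b c d e := by
      simpa [paramT, zT] using congrArg (algebraMap (Aring K) (adjoinT K a b c d e)) h
    change paramT K a b c d e n * algebraMap (Aring K) (adjoinT K a b c d e) r * s ∈ N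
    rw [h', add_mul, mul_assoc]
    exact add_mem (base p hs) (base q (closed hs).1)
  | add r r' hr hr' ih ih' =>
    obtain ⟨n, hn, h⟩ := ih
    obtain ⟨n', hn', h'⟩ := ih'
    refine ⟨n * n', by simp [hn, hn'], fun s hs => ?_⟩
    let ρ : adjoinT K a b c d e := ⟨r, hr⟩
    let ρ' : adjoinT K a b c d e := ⟨r', hr'⟩
    change paramT K a b c d e (n * n') * (ρ + ρ') * s ∈ N
    convert add_mem (base n' (h s hs)) (base n (h' s hs)) using 1
    rw [map_mul]
    ring
  | mul r r' hr hr' ih ih' =>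
    obtain ⟨n, hn, h⟩ := ih
    obtain ⟨n', hn', h'⟩ := ih'
    refine ⟨n * n', by simp [hn, hn'], fun s hs => ?_⟩
    let ρ : adjoinT K a b c d e := ⟨r, hr⟩
    let ρ' : adjoinT K a b c d e := ⟨r', hr'⟩
    change paramT K a b c d e (n * n') * (ρ * ρ') * s ∈ N
    convert h _ (h' s hs) using 1
    rw [map_mul]
    ring

theorem genT_linearIndependent [CharP K 2]
    (ha : a ^ 2 = toOmega K (uElt K * yElt K * zElt K))
    (hb : b ^ 2 = toOmega K (vElt K * xElt K * zElt K))
    (hc : c ^ 2 = toOmega K (wElt K * xElt K * yElt K))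
    (hd : d ^ 2 = toOmega K (uElt K * vElt K * wElt K))
    (he : e ^ 2 = toOmega K (vElt K * wElt K * yElt K * zElt K))
    (k : Fin 8 → MvPolynomial (Fin 5) K)
    (hk : ∑ i, paramT K a b c d e (k i) * genT K a b c d e i = 0) : k = 0 := by
  have h2 : (2 : adjoinT K a b c d e) = 0 :=
    two_eq_zero_of_ringHom ((paramT K a b c d e).comp C)
  have h2A : (2 : Aring K) = 0 := two_eq_zero_of_ringHom ((paramA K).comp C)
  have : CharP (adjoinT K a b c d e) 2 :=
    CharTwo.of_one_ne_zero_of_two_eq_zero one_ne_zero h2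
  have hsq := congrArg (· ^ 2) hk
  simp only [Fin.sum_univ_eight, CharTwo.add_sq, mul_pow] at hsq
  simp only [genT, Matrix.cons_val, mul_pow, aT_sq ha, bT_sq hb, cT_sq hc, dT_sq hd,
    eT_sq he] at hsq
  have hA : paramA K (k 0) ^ 2 + paramA K (k 1) ^ 2 * zElt K ^ 2
      + (paramA K (k 2) ^ 2 + paramA K (k 3) ^ 2 * zElt K ^ 2)
        * (vElt K * wElt K * yElt K * zElt K)
      + paramA K (k 4) ^ 2 * (uElt K * yElt K * zElt K)
      + paramA K (k 5) ^ 2 * (vElt K * xElt K * zElt K)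
      + paramA K (k 6) ^ 2 * (wElt K * xElt K * yElt K)
      + paramA K (k 7) ^ 2 * (uElt K * vElt K * wElt K) = 0 := by
    apply algebraMap_adjoinT_injective K a b c d e
    simp only [map_add, map_mul, map_pow, map_zero]
    simp only [paramT, RingHom.comp_apply, uT, vT, wT, xT, yT, zT] at hsq
    linear_combination hsq
  obtain ⟨h₀, h₁⟩ := eq_zero_of_coords_Aring K
    (p := k 0 ^ 2 + (X 0 * X 1 + X 2 * X 3) * k 1 ^ 2
      + X 2 * X 3 * (X 0 * X 1 + X 2 * X 3) * (k 2 ^ 2 + (X 0 * X 1 + X 2 * X 3) * k 3 ^ 2)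
      + X 1 * X 3 * X 4 * k 6 ^ 2 + X 0 * X 2 * X 4 * k 7 ^ 2)
    (q := X 4 * k 1 ^ 2 + X 4 * (X 2 * X 3 * (X 0 * X 1 + X 2 * X 3)) * k 3 ^ 2
      + X 0 * X 3 * k 4 ^ 2 + X 2 * X 1 * k 5 ^ 2 + X 1 * X 3 * k 6 ^ 2 + X 0 * X 2 * k 7 ^ 2) (by
    simp only [map_add, map_mul, map_pow, paramA_X_zero, paramA_X_one, paramA_X_two,
      paramA_X_three, paramA_X_four]
    linear_combination hA + (paramA K (k 1) ^ 2 + vElt K * yElt K * paramA K (k 2) ^ 2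
        - paramA K (k 3) ^ 2 * vElt K * yElt K
          * (zElt K ^ 2 - uElt K * xElt K - vElt K * yElt K)) * elt_relation K
      - (zElt K ^ 2 * paramA K (k 1) ^ 2
        + vElt K * yElt K * wElt K * zElt K * paramA K (k 2) ^ 2) * h2A)
  obtain ⟨e₀, e₁, e₂, e₃, e₄, e₅, e₆, e₇⟩ := coeffs_eq_zero_of_quad_relation h₁ h₀
  ext1 i
  fin_cases i <;> assumption

theorem mem_span_of_paramT_X_mul_mem [CharP K 2]
    (ha : a ^ 2 = toOmega K (uElt K * yElt K * zElt K))
    (hb : b ^ 2 = toOmega K (vElt K * xElt K * zElt K))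
    (hc : c ^ 2 = toOmega K (wElt K * xElt K * yElt K))
    (hd : d ^ 2 = toOmega K (uElt K * vElt K * wElt K))
    (he : e ^ 2 = toOmega K (vElt K * wElt K * yElt K * zElt K))
    {s : Set (Fin 5)} {k : Fin 5} (hk : k ∉ s)
    {r : adjoinT K a b c d e}
    (hr : paramT K a b c d e (X k) * r ∈
      Ideal.span ((fun i => paramT K a b c d e (X i)) '' s)) :
    r ∈ Ideal.span ((fun i => paramT K a b c d e (X i)) '' s) :=
  mem_span_of_X_mul_mem (genT_linearIndependent ha hb hc hd he)
    (exists_coords_adjoinT ha hb hc hd he)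
    (fun _ hn => (isUnit_paramA K hn).map (algebraMap (Aring K) (adjoinT K a b c d e))) hk hr

theorem quotient_eq_zero_of_paramT_X_mul [CharP K 2]
    (ha : a ^ 2 = toOmega K (uElt K * yElt K * zElt K))
    (hb : b ^ 2 = toOmega K (vElt K * xElt K * zElt K))
    (hc : c ^ 2 = toOmega K (wElt K * xElt K * yElt K))
    (hd : d ^ 2 = toOmega K (uElt K * vElt K * wElt K))
    (he : e ^ 2 = toOmega K (vElt K * wElt K * yElt K * zElt K))
    {s : Set (Fin 5)} {k : Fin 5} (hk : k ∉ s)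
    {I : Ideal (adjoinT K a b c d e)}
    (hI : I = Ideal.span ((fun i => paramT K a b c d e (X i)) '' s))
    (r : adjoinT K a b c d e ⧸ I)
    (hr : Ideal.Quotient.mk I (paramT K a b c d e (X k)) * r = 0) : r = 0 := by
  obtain ⟨r, rfl⟩ := Ideal.Quotient.mk_surjective r
  rw [← map_mul, Ideal.Quotient.eq_zero_iff_mem, hI] at hr
  rw [Ideal.Quotient.eq_zero_iff_mem, hI]
  exact mem_span_of_paramT_X_mul_mem ha hb hc hd he hk hr

end AdjoinedRing

/-- `u, x, v, y, w−z` is a regular sequence on `R = A[a,b,c,d,e]`: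
`u` is a nonzerodivisor on `R`, `x` is a nonzerodivisor on `R/(u)`, `v` is a nonzerodivisor
on `R/(u,x)`, `y` is a nonzerodivisor on `R/(u,x,v)`, `w−z` is a nonzerodivisor on
`R/(u,x,v,y)`, and `(u,x,v,y,w−z)R ≠ R`. -/
theorem regular_sequence_on_adjoined_ring
    (K : Type) [Field K] [CharP K 2] [(mIdeal K).IsPrime] [IsDomain (Aring K)]
    (a b c d e : Omega K)
    (ha : a ^ 2 = toOmega K (uElt K * yElt K * zElt K))
    (hb : b ^ 2 = toOmega K (vElt K * xElt K * zElt K))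
    (hc : c ^ 2 = toOmega K (wElt K * xElt K * yElt K))
    (hd : d ^ 2 = toOmega K (uElt K * vElt K * wElt K))
    (he : e ^ 2 = toOmega K (vElt K * wElt K * yElt K * zElt K)) :
    (∀ r : adjoinT K a b c d e, uT K a b c d e * r = 0 → r = 0) ∧
    (∀ r : adjoinT K a b c d e ⧸ Ideal.span {uT K a b c d e},
      Ideal.Quotient.mk _ (xT K a b c d e) * r = 0 → r = 0) ∧
    (∀ r : adjoinT K a b c d e ⧸ Ideal.span {uT K a b c d e, xT K a b c d e},
      Ideal.Quotient.mk _ (vT K a b c d e) * r = 0 → r = 0) ∧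
    (∀ r : adjoinT K a b c d e ⧸
        Ideal.span {uT K a b c d e, xT K a b c d e, vT K a b c d e},
      Ideal.Quotient.mk _ (yT K a b c d e) * r = 0 → r = 0) ∧
    (∀ r : adjoinT K a b c d e ⧸
        Ideal.span {uT K a b c d e, xT K a b c d e, vT K a b c d e, yT K a b c d e},
      Ideal.Quotient.mk _ (wT K a b c d e - zT K a b c d e) * r = 0 → r = 0) ∧
    Ideal.span {uT K a b c d e, xT K a b c d e, vT K a b c d e, yT K a b c d e,
      wT K a b c d e - zT K a b c d e} ≠ (⊤ : Ideal (adjoinT K a b c d e)) := by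
  have h0 := paramT_X_zero K a b c d e
  have h1 := paramT_X_one K a b c d e
  have h2 := paramT_X_two K a b c d e
  have h3 := paramT_X_three K a b c d e
  have h4 := paramT_X_four K a b c d e
  rw [← h0, ← h1, ← h2, ← h3, ← h4]
  refine ⟨fun r hr => ?_,
    quotient_eq_zero_of_paramT_X_mul ha hb hc hd he (s := {0}) (by simp) ?_,
    quotient_eq_zero_of_paramT_X_mul ha hb hc hd he (s := {0, 1}) (by simp) ?_,
    quotient_eq_zero_of_paramT_X_mul ha hb hc hd he (s := {0, 1, 2}) (by simp) ?_,
    quotient_eq_zero_of_paramT_X_mul ha hb hc hd he (s := {0, 1, 2, 3}) (by simp) ?_, ?_⟩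
  · have := mem_span_of_paramT_X_mul_mem ha hb hc hd he (s := ∅) (k := 0) (r := r) (by simp)
      (hr ▸ zero_mem _)
    simpa using this
  · simp only [Set.image_singleton]
  · simp only [Set.image_insert_eq, Set.image_singleton]
  · simp only [Set.image_insert_eq, Set.image_singleton]
  · simp only [Set.image_insert_eq, Set.image_singleton]
  · have := span_X_ne_top (genT_linearIndependent ha hb hc hd he)
      (exists_coords_adjoinT ha hb hc hd he) (i₀ := 0) rfl {0, 1, 2, 3, 4}
    simpa only [Set.image_insert_eq, Set.image_singleton] using this
end
end
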